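/- Let d be a positive even integer, n = 2^{d/2}, and γ₁, …, γ_d ∈ M_n(ℂ) matrices satisfying γᵢγⱼ + γⱼγᵢ = 2δᵢⱼ·1 for 1 ≤ i, j ≤ d; set γ₀ := (−i)^{d/2} γ₁⋯γ_d. Then for all y₁, …, y_d ∈ ℝ^d, tr( γ₀ (γ·y₁)(γ·y₂)⋯(γ·y_d) ) = (2i)^{d/2} · det(y₁, …, y_d), where det(y₁, …, y_d) is the determinant of the d×d real matrix whose j-th column is y_j. Equivalently, tr( γ₀ (γ·y₁)⋯(γ·y_d) ) = α_d · Vol[0, y₁, …, y_d] with α_d = (2i)^{d/2} d! and Vol[0, y₁, …, y_d] = det(y₁, …, y_d)/d! the signed volume of the simplex with vertices 0, y₁, …, y_d. -/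

import Mathlib

open scoped Classical

/-- `γ · v = Σ_j v_j γ_j`. -/
noncomputable def gammaDot {d n : ℕ} (γ : Fin d → Matrix (Fin n) (Fin n) ℂ)
    (v : EuclideanSpace ℝ (Fin d)) : Matrix (Fin n) (Fin n) ℂ :=
  ∑ j : Fin d, (v j : ℂ) • γ j

/-- The grading `γ₀ = (−i)^{d/2} γ₁ ⋯ γ_d`. -/
noncomputable def gammaZero {d n : ℕ} (γ : Fin d → Matrix (Fin n) (Fin n) ℂ) :
    Matrix (Fin n) (Fin n) ℂ :=
  ((-Complex.I) ^ (d / 2)) • ((List.finRange d).map γ).prod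

/-- An element anticommuting with every entry of a list moves past its product up to the sign
`(-1) ^ length`. -/
lemma mul_list_prod_of_anticomm {R : Type*} [Ring R] (x : R) (l : List R)
    (h : ∀ a ∈ l, x * a = -(a * x)) : x * l.prod = (-1) ^ l.length * (l.prod * x) := by
  induction l with
  | nil => simp
  | cons a t ih =>
    have ht := ih fun b hb => h b (List.mem_cons_of_mem _ hb)
    have hc := (Commute.neg_one_left a).pow_left t.length
    rw [List.prod_cons, ← mul_assoc, h a List.mem_cons_self, neg_mul, mul_assoc, ht,
      List.length_cons, pow_succ, ← mul_assoc a, ← hc.eq]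
    simp [mul_assoc]

/-- In an anticommuting family, each member of a duplicate-free product moves past that product
up to the sign `-(-1) ^ length`. -/
lemma mul_list_prod_of_mem {ι R : Type*} [Ring R] (g : ι → R)
    (hg : ∀ i j, i ≠ j → g i * g j = -(g j * g i)) (j : ι) (l : List ι) (hl : l.Nodup)
    (hj : j ∈ l) :
    g j * (l.map g).prod = -((-1) ^ l.length * ((l.map g).prod * g j)) := by
  induction l with
  | nil => simp at hj
  | cons a t ih =>
    obtain ⟨hat, ht⟩ := List.nodup_cons.1 hl
    have hc := (Commute.neg_one_left (g a)).pow_left t.length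
    simp only [List.map_cons, List.prod_cons, List.length_cons, pow_succ]
    by_cases haj : a = j
    · subst haj
      have h := mul_list_prod_of_anticomm (g a) (t.map g) (by
        intro b hb
        obtain ⟨i, hi, rfl⟩ := List.mem_map.1 hb
        exact hg _ _ fun h => hat (h ▸ hi))
      rw [List.length_map] at h
      nth_rw 1 [h]
      rw [← mul_assoc, ← hc.eq]
      simp [mul_assoc]
    · have hjt : j ∈ t := (List.mem_cons.1 hj).resolve_left (Ne.symm haj)
      rw [← mul_assoc, hg j a (Ne.symm haj), neg_mul, mul_assoc, ih ht hjt, mul_neg,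
        ← mul_assoc (g a), ← hc.eq]
      simp [mul_assoc]

/-- The square of a duplicate-free product of anticommuting square roots of `1`. -/
lemma list_prod_mul_self_of_anticomm {ι R : Type*} [Ring R] (g : ι → R)
    (hg : ∀ i j, i ≠ j → g i * g j = -(g j * g i)) (hg1 : ∀ i, g i * g i = 1)
    (l : List ι) (hl : l.Nodup) :
    (l.map g).prod * (l.map g).prod = (-1) ^ (l.length.choose 2) := by
  induction l with
  | nil => simp
  | cons a t ih =>
    obtain ⟨hat, ht⟩ := List.nodup_cons.1 hl
    have h := mul_list_prod_of_mem g hg a (a :: t) hl List.mem_cons_self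
    simp only [List.map_cons, List.prod_cons, List.length_cons] at h ⊢
    have h' : g a * (g a * (t.map g).prod) = (t.map g).prod := by
      rw [← mul_assoc, hg1, one_mul]
    rw [h', pow_succ] at h
    have hc := (Commute.neg_one_left (t.map g).prod).pow_left t.length
    have hsq : (t.map g).prod = (-1) ^ t.length * (g a * (t.map g).prod * g a) := by
      simpa using h
    have hs : ((-1 : R) ^ t.length) * (-1) ^ t.length = 1 := by
      rw [← pow_add, (Even.add_self _).neg_one_pow]
    have hsq' : g a * (t.map g).prod * g a = (-1) ^ t.length * (t.map g).prod := by
      calc g a * (t.map g).prod * g a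
          = ((-1 : R) ^ t.length * (-1) ^ t.length) * (g a * (t.map g).prod * g a) := by
            rw [hs, one_mul]
        _ = _ := by rw [mul_assoc, ← hsq]
    rw [← mul_assoc, hsq', mul_assoc, ih ht, ← pow_add, Nat.choose_succ_succ' t.length 1,
      Nat.choose_one_right]

section Clifford

variable {d n : ℕ} (γ : Fin d → Matrix (Fin n) (Fin n) ℂ)

/-- `gammaDot γ` as a real-linear map. -/
noncomputable def gammaDotLinear :
    EuclideanSpace ℝ (Fin d) →ₗ[ℝ] Matrix (Fin n) (Fin n) ℂ where
  toFun := gammaDot γ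
  map_add' v w := by simp [gammaDot, add_smul, Finset.sum_add_distrib]
  map_smul' c v := by
    simp only [gammaDot, Finset.smul_sum, RingHom.id_apply, PiLp.smul_apply, smul_eq_mul,
      Complex.ofReal_mul, mul_smul, Complex.coe_smul]

lemma gammaDot_single (i : Fin d) : gammaDot γ (EuclideanSpace.single i 1) = γ i := by
  rw [gammaDot, Finset.sum_eq_single i] <;> simp +contextual

lemma gamma_anticomm
    (hγ : ∀ i j, γ i * γ j + γ j * γ i = (if i = j then (2 : ℂ) else 0) • 1)
    (i j : Fin d) (hij : i ≠ j) : γ i * γ j = -(γ j * γ i) := by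
  have h := hγ i j
  rw [if_neg hij, zero_smul] at h
  exact eq_neg_of_add_eq_zero_left h

lemma gamma_mul_self
    (hγ : ∀ i j, γ i * γ j + γ j * γ i = (if i = j then (2 : ℂ) else 0) • 1)
    (i : Fin d) : γ i * γ i = 1 := by
  have h := hγ i i
  rw [if_pos rfl, ← two_smul ℂ] at h
  exact smul_right_injective _ (two_ne_zero' ℂ) h

lemma gammaDot_mul_add
    (hγ : ∀ i j, γ i * γ j + γ j * γ i = (if i = j then (2 : ℂ) else 0) • 1)
    (v w : EuclideanSpace ℝ (Fin d)) :
    gammaDot γ v * gammaDot γ w + gammaDot γ w * gammaDot γ v =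
      ((2 * ∑ j, v j * w j : ℝ) : ℂ) • 1 := by
  have h1 : gammaDot γ v * gammaDot γ w =
      ∑ i, ∑ j, ((v i : ℂ) * (w j : ℂ)) • (γ i * γ j) := by
    simp only [gammaDot, Finset.sum_mul_sum, smul_mul_smul_comm]
  have h2 : gammaDot γ w * gammaDot γ v =
      ∑ i, ∑ j, ((v i : ℂ) * (w j : ℂ)) • (γ j * γ i) := by
    simp only [gammaDot, Finset.sum_mul_sum, smul_mul_smul_comm]
    rw [Finset.sum_comm]
    simp only [mul_comm]
  rw [h1, h2]
  simp only [← Finset.sum_add_distrib, ← smul_add, hγ, smul_smul, ← Finset.sum_smul]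
  congr 1
  push_cast
  simp [Finset.mul_sum, mul_comm]

lemma gammaDot_mul_gammaZero
    (hγ : ∀ i j, γ i * γ j + γ j * γ i = (if i = j then (2 : ℂ) else 0) • 1)
    (hdeven : Even d) (w : EuclideanSpace ℝ (Fin d)) :
    gammaDot γ w * gammaZero γ = -(gammaZero γ * gammaDot γ w) := by
  have h (j : Fin d) : γ j * ((List.finRange d).map γ).prod =
      -(((List.finRange d).map γ).prod * γ j) := by
    simpa [hdeven.neg_one_pow] using
      mul_list_prod_of_mem γ (gamma_anticomm γ hγ) j _ (List.nodup_finRange d)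
        (List.mem_finRange j)
  simp only [gammaZero, gammaDot, Finset.sum_mul, Finset.mul_sum, smul_mul_smul_comm, h,
    smul_neg, Finset.sum_neg_distrib, mul_comm]

lemma trace_gammaZero_mul_eq_zero
    (hγ : ∀ i j, γ i * γ j + γ j * γ i = (if i = j then (2 : ℂ) else 0) • 1)
    (hdeven : Even d) (w : EuclideanSpace ℝ (Fin d)) (hw : w ≠ 0)
    (y : Fin d → EuclideanSpace ℝ (Fin d)) (hwy : ∀ i, ∑ j, w j * y i j = 0) :
    Matrix.trace (gammaZero γ *
      ((List.finRange d).map (fun i : Fin d => gammaDot γ (y i))).prod) = 0 := by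
  set P := ((List.finRange d).map (fun i : Fin d => gammaDot γ (y i))).prod
  have hWP : gammaDot γ w * P = P * gammaDot γ w := by
    have h := mul_list_prod_of_anticomm (gammaDot γ w)
      ((List.finRange d).map (fun i : Fin d => gammaDot γ (y i))) (by
        intro a ha
        obtain ⟨i, -, rfl⟩ := List.mem_map.1 ha
        have h := gammaDot_mul_add γ hγ w (y i)
        rw [hwy i] at h
        exact eq_neg_of_add_eq_zero_left (by simpa using h))
    simpa [hdeven.neg_one_pow] using h
  have hWW : gammaDot γ w * gammaDot γ w = ((∑ j, w j * w j : ℝ) : ℂ) • 1 := by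
    have h := gammaDot_mul_add γ hγ w w
    rw [← two_smul ℂ, Complex.ofReal_mul, mul_smul, Complex.ofReal_ofNat] at h
    exact smul_right_injective _ (two_ne_zero' ℂ) h
  have hne : (∑ j, w j * w j : ℝ) ≠ 0 := by
    intro h0
    refine hw (PiLp.ext fun j => ?_)
    have h := (Finset.sum_eq_zero_iff_of_nonneg fun j _ => mul_self_nonneg (w j)).1 h0 j
      (Finset.mem_univ j)
    simpa using h
  have hcycle : Matrix.trace (gammaDot γ w * (gammaZero γ * P) * gammaDot γ w) =
      Matrix.trace (gammaDot γ w * gammaDot γ w * (gammaZero γ * P)) := by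
    rw [Matrix.trace_mul_comm, mul_assoc]
  have hconj : gammaDot γ w * (gammaZero γ * P) * gammaDot γ w =
      -(gammaDot γ w * gammaDot γ w * (gammaZero γ * P)) := by
    rw [mul_assoc, mul_assoc (gammaZero γ), ← hWP, ← mul_assoc (gammaZero γ),
      ← neg_eq_iff_eq_neg.2 (gammaDot_mul_gammaZero γ hγ hdeven w)]
    simp [mul_assoc]
  rw [hconj, Matrix.trace_neg, hWW, smul_mul_assoc, one_mul, Matrix.trace_smul,
    neg_eq_self, smul_eq_zero] at hcycle
  exact hcycle.resolve_left (by exact_mod_cast hne)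

lemma trace_gammaZero_mul_prod
    (hγ : ∀ i j, γ i * γ j + γ j * γ i = (if i = j then (2 : ℂ) else 0) • 1)
    (hdeven : Even d) (hn : n = 2 ^ (d / 2)) :
    Matrix.trace (gammaZero γ * ((List.finRange d).map γ).prod) =
      (2 * Complex.I) ^ (d / 2) := by
  obtain ⟨m, rfl⟩ := hdeven
  have hm : (m + m) / 2 = m := by omega
  have hchoose : (m + m).choose 2 = m * (2 * m - 1) := by
    rw [Nat.choose_two_right, ← two_mul, mul_assoc, Nat.mul_div_cancel_left _ two_pos]
  have hsign : ((-1 : Matrix (Fin n) (Fin n) ℂ)) ^ (m * (2 * m - 1)) = (-1) ^ m := by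
    rcases m with _ | k
    · simp
    · have hodd : Odd (2 * (k + 1) - 1) := ⟨k, by omega⟩
      rw [mul_comm, pow_mul, hodd.neg_one_pow]
  have hsq := list_prod_mul_self_of_anticomm γ (gamma_anticomm γ hγ) (gamma_mul_self γ hγ) _
    (List.nodup_finRange (m + m))
  rw [List.length_finRange, hchoose, hsign] at hsq
  have hscalar : (-1 : Matrix (Fin n) (Fin n) ℂ) ^ m = ((-1 : ℂ) ^ m) • 1 := by
    rw [← neg_one_smul ℂ (1 : Matrix (Fin n) (Fin n) ℂ), smul_pow, one_pow]
  rw [gammaZero, smul_mul_assoc, hsq, hscalar, Matrix.trace_smul, Matrix.trace_smul,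
    Matrix.trace_one, Fintype.card_fin, hn, hm]
  push_cast
  rw [smul_eq_mul, smul_eq_mul, ← mul_pow, ← mul_pow]
  congr 1
  ring

/-- The map `y ↦ tr(γ₀ (γ·y₁) ⋯ (γ·y_d))` as an alternating map. -/
noncomputable def traceAlternating
    (hγ : ∀ i j, γ i * γ j + γ j * γ i = (if i = j then (2 : ℂ) else 0) • 1)
    (hdeven : Even d) :
    EuclideanSpace ℝ (Fin d) [⋀^Fin d]→ₗ[ℝ] ℂ where
  toMultilinearMap :=
    ((Matrix.traceLinearMap (Fin n) ℝ ℂ).comp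
      (LinearMap.mulLeft ℝ (gammaZero γ))).compMultilinearMap
      ((MultilinearMap.mkPiAlgebraFin ℝ d (Matrix (Fin n) (Fin n) ℂ)).compLinearMap
        fun _ => gammaDotLinear γ)
  map_eq_zero_of_eq' y i j hij hne := by
    have hdet : (Matrix.of fun i j : Fin d => y j i).det = 0 :=
      Matrix.det_zero_of_column_eq hne fun k => by simp [hij]
    obtain ⟨w, hw, hwy⟩ := Matrix.exists_vecMul_eq_zero_iff.2 hdet
    have h := trace_gammaZero_mul_eq_zero γ hγ hdeven (WithLp.toLp 2 w)
      (by simpa using hw) y (fun i => by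
        simpa [Matrix.vecMul, dotProduct] using congrFun hwy i)
    simpa [List.ofFn_eq_map, gammaDotLinear] using h

lemma traceAlternating_apply
    (hγ : ∀ i j, γ i * γ j + γ j * γ i = (if i = j then (2 : ℂ) else 0) • 1)
    (hdeven : Even d) (y : Fin d → EuclideanSpace ℝ (Fin d)) :
    traceAlternating γ hγ hdeven y = Matrix.trace (gammaZero γ *
      ((List.finRange d).map (fun i : Fin d => gammaDot γ (y i))).prod) := by
  rw [← List.ofFn_eq_map]
  rfl

end Clifford

/-- An alternating map of top degree is the determinant times its value on a basis. -/
lemma AlternatingMap.apply_eq_basis_det_smul {ι R M N : Type*} [Fintype ι] [DecidableEq ι]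
    [CommRing R] [AddCommGroup M] [Module R M] [AddCommGroup N] [Module R N]
    (e : Module.Basis ι R M) (f : M [⋀^ι]→ₗ[R] N) (y : ι → M) : f y = e.det y • f e := by
  have h : f = (LinearMap.toSpanSingleton R N (f e)).compAlternatingMap e.det := by
    refine Module.Basis.ext_alternating e fun v hv => ?_
    obtain ⟨σ, rfl⟩ : ∃ σ : Equiv.Perm ι, ⇑σ = v :=
      ⟨Equiv.ofBijective v (Finite.injective_iff_bijective.1 hv), rfl⟩
    have h1 := f.map_perm e σ
    have h2 := e.det.map_perm e σ
    simp only [Function.comp_def] at h1 h2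
    rw [h1, LinearMap.compAlternatingMap_apply, h2]
    simp [LinearMap.toSpanSingleton_apply, e.det_self]
  conv_lhs => rw [h]
  rfl

/-- the Clifford trace–determinant identity
`tr(γ₀ (γ·y₁) ⋯ (γ·y_d)) = (2i)^{d/2} det(y₁, …, y_d)` for `d` even. -/
theorem clifford_trace_det {d n : ℕ} (hd : 0 < d) (hdeven : Even d) (hn : n = 2 ^ (d / 2))
    (γ : Fin d → Matrix (Fin n) (Fin n) ℂ)
    (hγ : ∀ i j, γ i * γ j + γ j * γ i = (if i = j then (2 : ℂ) else 0) • 1)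
    (y : Fin d → EuclideanSpace ℝ (Fin d)) :
    Matrix.trace (gammaZero γ *
        ((List.finRange d).map (fun i : Fin d => gammaDot γ (y i))).prod) =
      (2 * Complex.I) ^ (d / 2) *
        ((Matrix.of fun i j : Fin d => y j i).det : ℂ) := by
  have h := AlternatingMap.apply_eq_basis_det_smul (EuclideanSpace.basisFun (Fin d) ℝ).toBasis
    (traceAlternating γ hγ hdeven) y
  simp only [traceAlternating_apply, OrthonormalBasis.coe_toBasis,
    EuclideanSpace.basisFun_apply, gammaDot_single] at h
  rw [h, trace_gammaZero_mul_prod γ hγ hdeven hn, Complex.real_smul, mul_comm,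
    Module.Basis.det_apply]
  rfl
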